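/- Let n = p^μ be a prime power with p ≥ 7, μ ≥ 2, and n ≥ 289. Let b, c be integers with c = b + 1 < n/2 and n/c > 4, such that (1, 1, c, n−b, n−3) is a minimal zero-sum sequence over Z/n. Then there exists a unit m modulo n with |m|_n + |m|_n + |m·c|_n + |m·(n−b)|_n + |m·(n−3)|_n = n. -/

import Mathlib

/-- `lpr n x` is the least positive residue of `x` modulo `n` (in `[1, n]`). -/
def lpr (n x : ℕ) : ℕ := if x % n = 0 then n else x % n

theorem lpr_eq_of_add_mul_eq {n x r q s : ℕ} (hr : 0 < r) (hrn : r < n)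
    (h : x + q * n = r + s * n) : lpr n x = r := by
  have hmod : x % n = r := by
    have := congrArg (· % n) h
    simpa [Nat.add_mul_mod_self_right, Nat.mod_eq_of_lt hrn] using this
  simp [lpr, hmod, hr.ne']

theorem sum_lpr_eq_of_lt_of_lt {n b m j : ℕ} (hb : b < n) (hlt : b * m < j * n)
    (hgt : j * n < (b + 1) * m) (hm : 3 * m < n) :
    lpr n m + lpr n m + lpr n (m * (b + 1)) + lpr n (m * (n - b)) + lpr n (m * (n - 3)) = n := by
  have hm0 : 0 < m := Nat.pos_of_ne_zero fun h => by simp [h] at hgt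
  have hexp : (b + 1) * m = b * m + m := by ring
  have h1 : lpr n m = m :=
    lpr_eq_of_add_mul_eq (q := 0) (s := 0) hm0 (by omega) (by simp)
  have h2 : lpr n (m * (b + 1)) = b * m + m - j * n :=
    lpr_eq_of_add_mul_eq (q := 0) (s := j) (by omega) (by omega) (by
      rw [Nat.sub_add_cancel (by omega)]; ring)
  have h3 : lpr n (m * (n - b)) = j * n - b * m :=
    lpr_eq_of_add_mul_eq (q := j) (s := m) (by omega) (by omega) (by
      zify [hb.le, hlt.le]; ring)
  have h4 : lpr n (m * (n - 3)) = n - 3 * m :=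
    lpr_eq_of_add_mul_eq (q := 1) (s := m) (by omega) (by omega) (by
      zify [show 3 ≤ n by omega, hm.le]; ring)
  rw [h1, h2, h3, h4]
  omega

/-- The least integer exceeding `j * n / (b + 1)`, shifted by `i`, stays below `j * n / b` when the
gap between the two bounds exceeds `i + 1`. -/
theorem div_add_one_add_mem {n b j i : ℕ} (hgap : (i + 1) * (b * (b + 1)) < j * n)
    (hj : 3 * j ≤ b) :
    b * (j * n / (b + 1) + 1 + i) < j * n ∧ j * n < (b + 1) * (j * n / (b + 1) + 1 + i) ∧
      3 * (j * n / (b + 1) + 1 + i) < n := by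
  have hle := Nat.mul_div_le (j * n) (b + 1)
  have hlt := Nat.lt_mul_div_succ (j * n) (Nat.succ_pos b)
  set f := j * n / (b + 1)
  have h1 : b * (f + 1 + i) < j * n := by
    have : (b + 1) * (b * (f + 1 + i)) < (b + 1) * (j * n) := by
      have := Nat.mul_le_mul_left b hle
      nlinarith
    exact Nat.lt_of_mul_lt_mul_left this
  refine ⟨h1, by nlinarith, ?_⟩
  have : b * (3 * (f + 1 + i)) < b * n := by
    have := Nat.mul_le_mul_right n hj
    nlinarith
  exact Nat.lt_of_mul_lt_mul_left this

theorem exists_not_dvd_between {n b p : ℕ} (hp : 7 ≤ p) (hn : 289 ≤ n) (hb : 3 ≤ b)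
    (hbn : 4 * (b + 1) < n) :
    ∃ m j : ℕ, ¬ p ∣ m ∧ b * m < j * n ∧ j * n < (b + 1) * m ∧ 3 * m < n := by
  by_contra! hcon
  have hdvd {j i : ℕ} (hgap : (i + 1) * (b * (b + 1)) < j * n) (hj : 3 * j ≤ b) :
      p ∣ j * n / (b + 1) + 1 + i := by
    by_contra hnd
    obtain ⟨h1, h2, h3⟩ := div_add_one_add_mem hgap hj
    exact absurd h3 (hcon _ _ hnd h1 h2).not_gt
  obtain ⟨k, hk, hkb⟩ : ∃ k, 3 * k ≤ b ∧ b ≤ 3 * k + 2 := ⟨b / 3, by omega, by omega⟩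
  have hsmall : k * n ≤ 2 * (b * (b + 1)) := by
    by_contra! hgap
    have h0 := hdvd (j := k) (i := 0) (by nlinarith) hk
    have h1 := hdvd (j := k) (i := 1) hgap hk
    have := Nat.le_of_dvd one_pos ((Nat.dvd_add_right h0).1 h1)
    omega
  have hb32 : 32 ≤ b := by
    by_contra! hb'
    have : k * 289 ≤ 2 * (b * (b + 1)) := (Nat.mul_le_mul_left k hn).trans hsmall
    interval_cases b <;> omega
  obtain ⟨l, rfl⟩ : ∃ l, k = l + 2 := ⟨k - 2, by omega⟩
  have hl : b * (b + 1) < l * n := by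
    have : b ≤ 4 * l := by omega
    nlinarith
  have d0 := hdvd (j := l) (i := 0) (by omega) (by omega)
  have d1 := hdvd (j := l + 1) (i := 0) (by nlinarith) (by omega)
  have d2 := hdvd (j := l + 2) (i := 0) (by nlinarith) (by omega)
  have hstep (j : ℕ) : j * n / (b + 1) + 1 ≤ (j + 1) * n / (b + 1) := by
    rw [Nat.le_div_iff_mul_le (Nat.succ_pos b)]
    have := Nat.div_mul_le_self (j * n) (b + 1)
    nlinarith
  have s0 := hstep l
  have s1 : (l + 1) * n / (b + 1) + 1 ≤ (l + 2) * n / (b + 1) := hstep (l + 1)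
  have e0 := Nat.le_of_dvd (by omega) (Nat.dvd_sub d1 d0)
  have e1 := Nat.le_of_dvd (by omega) (Nat.dvd_sub d2 d1)
  have hfar : l * n / (b + 1) + 14 ≤ (l + 2) * n / (b + 1) := by omega
  have hlt := Nat.lt_mul_div_succ (l * n) (Nat.succ_pos b)
  have hle := Nat.mul_div_le ((l + 2) * n) (b + 1)
  have hwide : 13 * (b + 1) < 2 * n := by nlinarith
  nlinarith

theorem stmt_15 (p μ n b c : ℕ) (hp : p.Prime) (hp7 : 7 ≤ p) (hμ : 2 ≤ μ)
    (hn : n = p ^ μ) (hn289 : 289 ≤ n)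
    (hbc : c = b + 1) (hc : 2 * c < n) (hc4 : 4 * c < n)
    (hzs : n ∣ ∑ i, (![1, 1, c, n - b, n - 3] : Fin 5 → ℕ) i)
    (hmin : ∀ s : Finset (Fin 5), s.Nonempty → s ≠ Finset.univ →
      ¬ n ∣ ∑ i ∈ s, (![1, 1, c, n - b, n - 3] : Fin 5 → ℕ) i) :
    ∃ m : ℕ, Nat.gcd m n = 1 ∧
      lpr n m + lpr n m + lpr n (m * c) + lpr n (m * (n - b)) +
        lpr n (m * (n - 3)) = n := by
  subst hbc
  have hb : 3 ≤ b := by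
    by_contra! hb
    interval_cases b
    · exact hmin {3} (by decide) (by decide) (by simp)
    · exact hmin {0, 3} (by decide) (by decide) (by
        simp [show 1 + (n - 1) = n by omega])
    · exact hmin {2, 4} (by decide) (by decide) (by
        simp [show 3 + (n - 3) = n by omega])
  obtain ⟨m, j, hpm, h1, h2, h3⟩ := exists_not_dvd_between hp7 hn289 hb hc4
  refine ⟨m, ?_, sum_lpr_eq_of_lt_of_lt (by omega) h1 h2 h3⟩
  rw [hn]
  exact (((Nat.Prime.coprime_iff_not_dvd hp).2 hpm).symm).pow_right μ
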